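/- Let R be a commutative ring whose total ring of quotients Q (the localization of R at the multiplicative set of non-zerodivisors) is self FP-injective. Then R is semicoherent if and only if Q is coherent. -/

import Mathlib

universe u

/-- A ring is *coherent* if every finitely generated ideal is finitely presented. -/
def IsCoherentRing (R : Type u) [CommRing R] : Prop :=
  ∀ I : Ideal R, I.FG → Module.FinitePresentation R I

/-- A ring is *semicoherent* if `Hom_R(E, F)` is (isomorphic to) a submodule of a flat module
for every pair of injective modules `E`, `F`. -/
def IsSemicoherentRing (R : Type u) [CommRing R] : Prop :=
  ∀ (E F : Type u) [AddCommGroup E] [Module R E] [AddCommGroup F] [Module R F],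
    Module.Injective R E → Module.Injective R F →
      ∃ G : ModuleCat.{u} R, Module.Flat R G ∧
        ∃ i : (E →ₗ[R] F) →ₗ[R] G, Function.Injective i

/-- An `R`-module `E` is *FP-injective* if `Ext¹_R(F, E) = 0` for every finitely
presented `R`-module `F`. -/
def IsFPInjective (R : Type u) [CommRing R] (E : Type u) [AddCommGroup E] [Module R E] : Prop :=
  ∀ (F : Type u) [AddCommGroup F] [Module R F], Module.FinitePresentation R F →
    Subsingleton (((Ext R (ModuleCat.{u} R) 1).obj
      (Opposite.op (ModuleCat.of R F))).obj (ModuleCat.of R E))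

/-- A ring is an *IF-ring* if every injective module over it is flat. -/
def IsIFRing (R : Type u) [CommRing R] : Prop :=
  ∀ (M : Type u) [AddCommGroup M] [Module R M], Module.Injective R M → Module.Flat R M

/-- `f : M →ₗ[R] E` exhibits `E` as an injective hull of `M`: `E` is injective and
`f` embeds `M` as an essential submodule of `E`. -/
def IsInjectiveHull (R : Type u) [CommRing R] (M E : Type u) [AddCommGroup M] [Module R M]
    [AddCommGroup E] [Module R E] (f : M →ₗ[R] E) : Prop :=
  Module.Injective R E ∧ Function.Injective f ∧
    ∀ N : Submodule R E, N ≠ ⊥ → N ⊓ LinearMap.range f ≠ ⊥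

/-- A module is indecomposable if it is nonzero and not the direct sum
of two nonzero submodules. -/
def IsIndecomposableModule (R : Type u) [CommRing R] (M : Type u) [AddCommGroup M]
    [Module R M] : Prop :=
  Nontrivial M ∧ ∀ A B : Submodule R M, IsCompl A B → A = ⊥ ∨ B = ⊥

/-- A module has *finite Goldie dimension* if its injective hull is a finite direct
sum of indecomposable injective modules. -/
def HasFiniteGoldieDimension (R : Type u) [CommRing R] (M : Type u) [AddCommGroup M]
    [Module R M] : Prop :=
  ∃ (E : ModuleCat.{u} R) (f : M →ₗ[R] E), IsInjectiveHull R M E f ∧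
    ∃ (n : ℕ) (D : Fin n → Submodule R E), DirectSum.IsInternal D ∧
      ∀ i, Module.Injective R (D i) ∧ IsIndecomposableModule R (D i)

/-- A commutative ring is a *valuation ring* (uniserial) if its ideals are totally
ordered by inclusion. -/
def IsChainRing (R : Type u) [CommRing R] : Prop :=
  ∀ I J : Ideal R, I ≤ J ∨ J ≤ I

/-- A commutative ring is *arithmetical* if all its localizations at maximal ideals are
valuation rings. -/
def IsArithmetical (R : Type u) [CommRing R] : Prop :=
  ∀ (P : Ideal R) (hP : P.IsMaximal),
    haveI := hP.isPrime
    IsChainRing (Localization.AtPrime P)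

/-- An `R`-module `M` is *finitely injective* if every homomorphism `A → M` from a finitely
generated submodule `A` of an arbitrary module `B` extends to `B`. -/
def IsFinitelyInjective (R : Type u) [CommRing R] (M : Type u) [AddCommGroup M]
    [Module R M] : Prop :=
  ∀ (B : Type u) [AddCommGroup B] [Module R B] (A : Submodule R B), A.FG →
    ∀ f : A →ₗ[R] M, ∃ g : B →ₗ[R] M, ∀ a : A, g a = f a

/-- A domain has *finite character* if every nonzero element lies in only finitely many
maximal ideals. -/
def FiniteCharacter (R : Type u) [CommRing R] : Prop :=
  ∀ r : R, r ≠ 0 → {P : Ideal R | P.IsMaximal ∧ r ∈ P}.Finite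


open CategoryTheory in
theorem fp_extend (A : Type u) [CommRing A] (hA : IsFPInjective A A)
    (M : Type u) [AddCommGroup M] [Module A M] [Module.Free A M] [Module.Finite A M]
    (N : Submodule A M) (hN : N.FG) (f : N →ₗ[A] A) :
    ∃ g : M →ₗ[A] A, ∀ n : N, g n = f n := by
  have : Module.FinitePresentation A (M ⧸ N) :=
    Module.finitePresentation_of_free_of_surjective N.mkQ N.mkQ_surjective (by simpa using hN)
  have hsub := hA (M ⧸ N) this
  let P : ProjectiveResolution (ModuleCat.of A (M ⧸ N)) := projectiveResolution _
  let p0 : P.complex.X 0 ⟶ ModuleCat.of A (M ⧸ N) := P.π.f 0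
  let q : ModuleCat.of A M ⟶ ModuleCat.of A (M ⧸ N) := ModuleCat.ofHom N.mkQ
  have hq : Epi q := (ModuleCat.epi_iff_surjective q).mpr N.mkQ_surjective
  have hp0 : Epi p0 := inferInstanceAs (Epi (P.π.f 0))
  have hM : Projective (ModuleCat.of A M) := (IsProjective.iff_projective M).mp inferInstance
  obtain ⟨α, hα⟩ : ∃ α, α ≫ q = p0 := ⟨_, Projective.factorThru_comp p0 q⟩
  obtain ⟨s, hs⟩ : ∃ s, s ≫ p0 = q := ⟨_, Projective.factorThru_comp q p0⟩
  have hα' : ∀ x, N.mkQ (α.hom x) = p0.hom x := fun x => by rw [← hα]; rfl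
  have hs' : ∀ x, p0.hom (s.hom x) = N.mkQ x := fun x => by
    change (s ≫ p0).hom x = _
    rw [hs]; rfl
  have hd : P.complex.d 1 0 ≫ p0 = 0 := P.complex_d_comp_π_f_zero
  have hd' : ∀ x, p0.hom ((P.complex.d 1 0).hom x) = 0 := fun x => by
    change (P.complex.d 1 0 ≫ p0).hom x = _
    rw [hd]; rfl
  let β : P.complex.X 1 →ₗ[A] N := LinearMap.codRestrict N (α.hom ∘ₗ (P.complex.d 1 0).hom)
    (fun x => by
      rw [← Submodule.Quotient.mk_eq_zero, ← Submodule.mkQ_apply]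
      exact (hα' _).trans (hd' x))
  have hdd : ∀ x, (P.complex.d 1 0).hom ((P.complex.d 2 1).hom x) = 0 := fun x => by
    change (P.complex.d 2 1 ≫ P.complex.d 1 0).hom x = _
    rw [P.complex.d_comp_d]; rfl
  let c : P.complex.X 1 ⟶ ModuleCat.of A A := ModuleCat.ofHom (f ∘ₗ β)
  have hc : P.complex.d 2 1 ≫ c = 0 := by
    ext x
    change f (β ((P.complex.d 2 1).hom x)) = 0
    have : β ((P.complex.d 2 1).hom x) = 0 := by
      apply Subtype.ext
      change α.hom ((P.complex.d 1 0).hom ((P.complex.d 2 1).hom x)) = 0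
      rw [hdd, map_zero]
    rw [this, map_zero]
  -- exactness
  have hex : ∃ h : P.complex.X 0 ⟶ ModuleCat.of A A, P.complex.d 1 0 ≫ h = c := by
    let L := P.complex.linearYonedaObj A (ModuleCat.of A A)
    have h0 : Limits.IsZero (L.homology 1) := by
      refine Limits.IsZero.of_iso ?_ (P.isoExt (R := A) 1 (ModuleCat.of A A)).symm
      exact ModuleCat.isZero_of_subsingleton _
    rw [← HomologicalComplex.exactAt_iff_isZero_homology,
      HomologicalComplex.exactAt_iff' _ 0 1 2 (by simp) (by simp),
      ShortComplex.moduleCat_exact_iff] at h0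
    obtain ⟨h, hh⟩ := h0 c hc
    exact ⟨h, hh⟩
  obtain ⟨h, hh⟩ := hex
  have hh' : ∀ x, h.hom ((P.complex.d 1 0).hom x) = f (β x) := fun x => by
    change (P.complex.d 1 0 ≫ h).hom x = _
    rw [hh]; rfl
  have hex0 : ∀ y, p0.hom y = 0 → ∃ x, (P.complex.d 1 0).hom x = y := by
    have := P.exact₀
    rw [ShortComplex.moduleCat_exact_iff] at this
    exact this
  let γ : M →ₗ[A] N := LinearMap.codRestrict N (α.hom ∘ₗ s.hom - LinearMap.id) (fun x => by
    rw [← Submodule.Quotient.mk_eq_zero, ← Submodule.mkQ_apply, LinearMap.sub_apply, map_sub,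
      sub_eq_zero]
    exact (hα' _).trans (hs' x))
  refine ⟨h.hom ∘ₗ s.hom - f ∘ₗ γ, fun n => ?_⟩
  obtain ⟨x, hx⟩ := hex0 (s.hom n.1) (by rw [hs']; simp)
  have hγ : γ n.1 = β x - n := by
    apply Subtype.ext
    change α.hom (s.hom n.1) - n.1 = α.hom ((P.complex.d 1 0).hom x) - n.1
    rw [hx]
  change h.hom (s.hom n.1) - f (γ n.1) = f n
  rw [hγ, ← hx, hh', map_sub]
  abel

theorem fp_ideal_extend (A : Type u) [CommRing A] (hA : IsFPInjective A A)
    (I : Ideal A) (hI : I.FG) (f : I →ₗ[A] A) : ∃ c : A, ∀ x : I, f x = x.1 * c := by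
  obtain ⟨g, hg⟩ := fp_extend A hA A I hI f
  refine ⟨g 1, fun x => ?_⟩
  rw [← hg, ← smul_eq_mul, ← map_smul, smul_eq_mul, mul_one]

theorem exists_factor_surj {A X Y Z : Type*} [CommRing A] [AddCommGroup X] [Module A X]
    [AddCommGroup Y] [Module A Y] [AddCommGroup Z] [Module A Z] (p : X →ₗ[A] Y)
    (hp : Function.Surjective p) (g : X →ₗ[A] Z) (h : ∀ x, p x = 0 → g x = 0) :
    ∃ g' : Y →ₗ[A] Z, ∀ x, g' (p x) = g x := by
  refine ⟨(LinearMap.ker p).liftQ g (fun x hx => h x hx) ∘ₗ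
    (p.quotKerEquivOfSurjective hp).symm.toLinearMap, fun x => ?_⟩
  have : (p.quotKerEquivOfSurjective hp).symm (p x) = (LinearMap.ker p).mkQ x := by
    rw [LinearEquiv.symm_apply_eq]; rfl
  rw [LinearMap.comp_apply, LinearEquiv.coe_coe, this]
  rfl

theorem exists_factor_range {A X Y Z : Type*} [CommRing A] [AddCommGroup X] [Module A X]
    [AddCommGroup Y] [Module A Y] [AddCommGroup Z] [Module A Z] (p : X →ₗ[A] Y)
    (g : X →ₗ[A] Z) (h : ∀ x, p x = 0 → g x = 0) :
    ∃ g' : LinearMap.range p →ₗ[A] Z, ∀ x, g' (p.rangeRestrict x) = g x :=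
  exists_factor_surj p.rangeRestrict p.surjective_rangeRestrict g fun x hx => h x (by
    have := congrArg Subtype.val hx
    exact this)

theorem double_annihilator (A : Type u) [CommRing A] (hA : IsFPInjective A A) {l : ℕ}
    (f v : Fin l →₀ A) (h : ∀ φ : Module.Dual A (Fin l →₀ A), φ f = 0 → φ v = 0) :
    ∃ c : A, v = c • f := by
  let ev := Module.Dual.eval A (Fin l →₀ A) f
  have hfg : (LinearMap.range ev).FG := Module.Finite.iff_fg.mp inferInstance
  obtain ⟨g, hg⟩ := exists_factor_surj ev.rangeRestrict ev.surjective_rangeRestrict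
    (Module.Dual.eval A (Fin l →₀ A) v) (fun φ hφ => h φ (congrArg Subtype.val hφ))
  obtain ⟨c, hc⟩ := fp_ideal_extend A hA _ hfg g
  refine ⟨c, ?_⟩
  ext i
  have h1 := hg (Finsupp.lapply i)
  rw [hc] at h1
  have h2 : f i * c = v i := h1
  rw [← h2]
  simp [mul_comm]

theorem flat_of_injective_of_coherent (A : Type u) [CommRing A] (hA : IsFPInjective A A)
    (hc : IsCoherentRing A) (M : Type u) [AddCommGroup M] [Module A M]
    (hM : Module.Injective A M) : Module.Flat A M := by
  refine Module.Flat.of_forall_exists_factorization fun {l f x} hxf => ?_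
  let ev := Module.Dual.eval A (Fin l →₀ A) f
  have hfg : (LinearMap.range ev).FG := Module.Finite.iff_fg.mp inferInstance
  have hfp : Module.FinitePresentation A (LinearMap.range ev) := hc _ hfg
  have hK : (LinearMap.ker ev).FG := by
    have := Module.FinitePresentation.fg_ker ev.rangeRestrict ev.surjective_rangeRestrict
    rwa [LinearMap.ker_rangeRestrict] at this
  obtain ⟨k, s, hs⟩ := Submodule.fg_iff_exists_fin_generating_family.mp hK
  let Φ : (Fin l →₀ A) →ₗ[A] (Fin k →₀ A) :=
    (Finsupp.linearEquivFunOnFinite A A (Fin k)).symm.toLinearMap ∘ₗ LinearMap.pi s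
  have hΦ : ∀ v j, Φ v j = s j v := fun v j => rfl
  have hker : ∀ v, Φ v = 0 → x v = 0 := by
    intro v hv
    obtain ⟨c, rfl⟩ := double_annihilator A hA f v (fun φ hφ => by
      have h1 : φ ∈ Submodule.span A (Set.range s) := by rw [hs]; exact hφ
      induction h1 using Submodule.span_induction with
      | mem y hy => obtain ⟨j, rfl⟩ := hy; rw [← hΦ, hv]; rfl
      | zero => rfl
      | add y z hy' hz' hy hz =>
        have e1 : y f = 0 := by
          rw [hs] at hy'; exact hy'
        have e2 : z f = 0 := by
          rw [hs] at hz'; exact hz'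
        simp [hy e1, hz e2]
      | smul a y hy' hy =>
        have e1 : y f = 0 := by
          rw [hs] at hy'; exact hy'
        simp [hy e1])
    rw [map_smul, hxf, smul_zero]
  obtain ⟨h, hh⟩ := exists_factor_range Φ x hker
  obtain ⟨y, hy⟩ := hM.out (X := LinearMap.range Φ) (Y := Fin k →₀ A) (LinearMap.range Φ).subtype (Submodule.subtype_injective _) h
  refine ⟨k, Φ, y, ?_, ?_⟩
  · apply LinearMap.ext
    intro v
    rw [← hh v, ← hy]; rfl
  · ext j
    have h1 : s j ∈ LinearMap.ker ev := by
      rw [← hs]; exact Submodule.subset_span ⟨j, rfl⟩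
    exact h1

open CategoryTheory in
theorem exists_injective_embedding (A : Type u) [CommRing A] (M : Type u) [AddCommGroup M]
    [Module A M] : ∃ (J : Type u) (_ : AddCommGroup J) (_ : Module A J), Module.Injective A J ∧
      ∃ i : M →ₗ[A] J, Function.Injective i := by
  let J := Injective.under (ModuleCat.of A M)
  refine ⟨J, inferInstance, inferInstance, ?_, (Injective.ι (ModuleCat.of A M)).hom, ?_⟩
  · have : Injective (ModuleCat.of A J) := inferInstanceAs (Injective J)
    exact Module.injective_module_of_injective_object A J
  · exact (ModuleCat.mono_iff_injective _).mp inferInstance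

theorem coherent_of_embed (A : Type u) [CommRing A] (hA : IsFPInjective A A)
    (H : ∀ (l : ℕ) (f : Fin l → A), ∃ (G : Type u) (_ : AddCommGroup G) (_ : Module A G),
      Module.Flat A G ∧ ∃ x : (Fin l → A) →ₗ[A] G, x f = 0 ∧ ∀ v, x v = 0 → ∃ c : A, v = c • f) :
    IsCoherentRing A := by
  intro I hI
  obtain ⟨l, f, hf⟩ := Submodule.fg_iff_exists_fin_generating_family.mp hI
  let L : (Fin l → A) →ₗ[A] A := Fintype.linearCombination A f
  have hL : LinearMap.range L = I := by rw [Fintype.range_linearCombination]; exact hf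
  obtain ⟨G, _, _, hG, x, hxf, hx⟩ := H l f
  obtain ⟨k, a, y, hya, haf⟩ := Module.Flat.exists_factorization_of_apply_eq_zero_of_free hxf
  let row : Fin k → Fin l → A := fun j i => a (Pi.single i 1) j
  have hdec : ∀ w : Fin l → A, w = ∑ i, w i • Pi.single i (1 : A) := fun w => by
    ext j; simp [Finset.sum_apply, Pi.single_apply]
  have hker : LinearMap.ker L = Submodule.span A (Set.range row) := by
    apply le_antisymm
    · intro v hv
      let φ : (Fin l → A) →ₗ[A] A := Fintype.linearCombination A v
      have hφf : φ f = 0 := by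
        have : L v = 0 := hv
        simp only [L, φ, Fintype.linearCombination_apply, smul_eq_mul] at this ⊢
        rw [← this]
        exact Finset.sum_congr rfl fun i _ => mul_comm _ _
      have hk : ∀ w, a w = 0 → φ w = 0 := fun w hw => by
        obtain ⟨c, rfl⟩ := hx w (by rw [hya]; simp [hw])
        rw [map_smul, hφf, smul_zero]
      obtain ⟨g, hg⟩ := exists_factor_range a φ hk
      obtain ⟨ψ, hψ⟩ := fp_extend A hA _ (LinearMap.range a)
        (Module.Finite.iff_fg.mp inferInstance) g
      have hψ' : ∀ w, ψ (a w) = φ w := fun w => by rw [← hg, ← hψ]; rfl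
      have hv' : v = ∑ j, ψ (Finsupp.single j 1) • row j := by
        ext i
        have h1 : v i = ψ (a (Pi.single i 1)) := by
          rw [hψ']; simp [φ]
        rw [h1]
        conv_lhs => rw [← Finsupp.univ_sum_single (a (Pi.single i 1)), map_sum]
        rw [Finset.sum_apply]
        refine Finset.sum_congr rfl fun j _ => ?_
        rw [← mul_one (a (Pi.single i 1) j), ← smul_eq_mul, ← Finsupp.smul_single, map_smul]
        simp [row, mul_comm]
      rw [hv']
      exact Submodule.sum_mem _ fun j _ => Submodule.smul_mem _ _ (Submodule.subset_span ⟨j, rfl⟩)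
    · rw [Submodule.span_le]
      rintro _ ⟨j, rfl⟩
      change L (row j) = 0
      have h1 : a f j = 0 := by rw [haf]; rfl
      rw [hdec f, map_sum, Finsupp.finsetSum_apply] at h1
      rw [← h1, Fintype.linearCombination_apply]
      refine Finset.sum_congr rfl fun i _ => ?_
      rw [map_smul]
      simp [row, mul_comm]
  rw [← hL]
  refine Module.finitePresentation_of_free_of_surjective L.rangeRestrict
    L.surjective_rangeRestrict ?_
  rw [LinearMap.ker_rangeRestrict, hker]
  exact Submodule.fg_span (Set.finite_range row)

theorem injective_restrict (R Q : Type u) [CommRing R] [CommRing Q] [Algebra R Q]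
    [Module.Flat R Q] (E : Type u) [AddCommGroup E] [Module Q E] [Module R E]
    [IsScalarTower R Q E] (hE : Module.Injective Q E) : Module.Injective R E := by
  refine ⟨fun X Y _ _ _ _ f hf g => ?_⟩
  have hinj : Function.Injective (f.baseChange Q) :=
    Module.Flat.lTensor_preserves_injective_linearMap f hf
  obtain ⟨h, hh⟩ := hE.out (f.baseChange Q) hinj (LinearMap.liftBaseChange Q g)
  refine ⟨h.restrictScalars R ∘ₗ TensorProduct.mk R Q Y 1, fun x => ?_⟩
  have := hh (1 ⊗ₜ x)
  simpa using this

theorem embed_aux (A : Type u) [CommRing A] (hA : IsFPInjective A A)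
    (E : Type u) [AddCommGroup E] [Module A E] (ι : A →ₗ[A] E) (hι : Function.Injective ι)
    {l : ℕ} (f v : Fin l → A) (e : E) (h : ∀ i, f i • e = v i • ι 1) : ∃ c : A, v = c • f := by
  let I : Ideal A := Ideal.span (Set.range f)
  have hI : I.FG := Submodule.fg_span (Set.finite_range f)
  have hmem : ∀ a ∈ I, a • e ∈ LinearMap.range ι := by
    intro a ha
    have : I ≤ (LinearMap.range ι).comap (LinearMap.toSpanSingleton A E e) := by
      refine Submodule.span_le.mpr ?_
      rintro _ ⟨i, rfl⟩
      exact ⟨v i, by simp [h, ← map_smul]⟩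
    exact this ha
  let g : I →ₗ[A] LinearMap.range ι := LinearMap.codRestrict _
    (LinearMap.toSpanSingleton A E e ∘ₗ I.subtype) (fun a => hmem a.1 a.2)
  obtain ⟨c, hc⟩ := fp_ideal_extend A hA I hI ((LinearEquiv.ofInjective ι hι).symm.toLinearMap ∘ₗ g)
  refine ⟨c, ?_⟩
  ext i
  have h1 := hc ⟨f i, Ideal.subset_span ⟨i, rfl⟩⟩
  have h2 : g ⟨f i, Ideal.subset_span ⟨i, rfl⟩⟩ = LinearEquiv.ofInjective ι hι (v i) := by
    apply Subtype.ext
    change f i • e = ι (v i)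
    rw [h, ← map_smul]; simp
  rw [LinearMap.comp_apply, h2] at h1
  have h3 : v i = f i * c := by simpa using h1
  rw [h3]; simp [mul_comm]

theorem semicoherent_of_coherent (R : Type u) [CommRing R]
    (hQ : IsFPInjective (Localization (nonZeroDivisors R)) (Localization (nonZeroDivisors R)))
    (hc : IsCoherentRing (Localization (nonZeroDivisors R))) : IsSemicoherentRing R := by
  intro E F _ _ _ _ hE hF
  let Q := Localization (nonZeroDivisors R)
  let M := E →ₗ[R] F
  obtain ⟨J, _, _, hJ, i, hi⟩ := exists_injective_embedding Q (TensorProduct R Q M)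
  let : Module R J := Module.compHom J (algebraMap R Q)
  have : IsScalarTower R Q J := ⟨fun r q j => by
    rw [Algebra.smul_def, mul_smul]; rfl⟩
  have hflatQ : Module.Flat Q J := flat_of_injective_of_coherent Q hQ hc J hJ
  have hRQ : Module.Flat R Q := IsLocalization.flat Q (nonZeroDivisors R)
  have hflat : Module.Flat R J := Module.Flat.trans R Q J
  refine ⟨ModuleCat.of R J, hflat, i.restrictScalars R ∘ₗ TensorProduct.mk R Q M 1, ?_⟩
  refine hi.comp ?_
  have hloc : IsLocalizedModule (nonZeroDivisors R) (TensorProduct.mk R Q M 1) :=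
    (isLocalizedModule_iff_isBaseChange (nonZeroDivisors R) Q _).mpr
      (TensorProduct.isBaseChange R M Q)
  rw [injective_iff_map_eq_zero]
  intro m hm
  obtain ⟨s, hs⟩ := (IsLocalizedModule.eq_zero_iff (nonZeroDivisors R) _).mp hm
  apply LinearMap.ext
  intro e
  obtain ⟨h, hh⟩ := (Module.Baer.of_injective hE).extension_property
    (LinearMap.toSpanSingleton R R s.1)
    (fun a b hab => by
      have : a * s.1 = b * s.1 := hab
      exact (mul_cancel_right_mem_nonZeroDivisors s.2).mp this)
    (LinearMap.toSpanSingleton R E e)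
  have h1 : s.1 • h 1 = e := by
    have := LinearMap.congr_fun hh 1
    rw [← map_smul]
    simpa using this
  rw [← h1, map_smul]
  exact LinearMap.congr_fun hs (h 1)

theorem coherent_of_semicoherent (R : Type u) [CommRing R]
    (hQ : IsFPInjective (Localization (nonZeroDivisors R)) (Localization (nonZeroDivisors R)))
    (hR : IsSemicoherentRing R) : IsCoherentRing (Localization (nonZeroDivisors R)) := by
  let Q := Localization (nonZeroDivisors R)
  have hRQ : Module.Flat R Q := IsLocalization.flat Q (nonZeroDivisors R)
  refine coherent_of_embed Q hQ fun l f => ?_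
  obtain ⟨E, _, _, hE, ι, hι⟩ := exists_injective_embedding Q Q
  let T : E →ₗ[Q] (Fin l → E) := LinearMap.pi fun i => LinearMap.lsmul Q E (f i)
  obtain ⟨F, _, _, hF, j, hj⟩ :=
    exists_injective_embedding Q ((Fin l → E) ⧸ LinearMap.range T)
  let : Module R E := Module.compHom E (algebraMap R Q)
  have : IsScalarTower R Q E := ⟨fun r q j => by
    rw [Algebra.smul_def, mul_smul]; rfl⟩
  let : Module R F := Module.compHom F (algebraMap R Q)
  have : IsScalarTower R Q F := ⟨fun r q j => by
    rw [Algebra.smul_def, mul_smul]; rfl⟩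
  obtain ⟨G, hG, i, hi⟩ := hR E F (injective_restrict R Q E hE) (injective_restrict R Q F hF)
  let B : (Fin l → Q) →ₗ[Q] E →ₗ[Q] (Fin l → E) := LinearMap.mk₂ Q (fun v e i => v i • e)
    (fun v w e => by ext i; simp [add_smul]) (fun c v e => by ext i; simp [mul_smul])
    (fun v e e' => by ext i; simp) (fun c v e => by ext i; simp [smul_comm c])
  let x0 : (Fin l → Q) →ₗ[Q] E →ₗ[Q] F := B.compr₂ (j ∘ₗ (LinearMap.range T).mkQ)
  have hx0 : ∀ v e, x0 v e = j ((LinearMap.range T).mkQ (fun i => v i • e)) := fun v e => rfl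
  let x1 : (Fin l → Q) →ₗ[R] (E →ₗ[R] F) :=
    { toFun := fun v => (x0 v).restrictScalars R
      map_add' := fun v w => by ext e; simp
      map_smul' := fun r v => by
        ext e
        have : r • v = algebraMap R Q r • v := (algebraMap_smul Q r v).symm
        rw [this, map_smul]
        rfl }
  let x2 : (Fin l → Q) →ₗ[R] TensorProduct R Q G := TensorProduct.mk R Q G 1 ∘ₗ i ∘ₗ x1
  let x : (Fin l → Q) →ₗ[Q] TensorProduct R Q G :=
    x2.extendScalarsOfIsLocalization (nonZeroDivisors R) Q
  refine ⟨TensorProduct R Q G, inferInstance, inferInstance, inferInstance, x, ?_, ?_⟩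
  · have h0 : x1 f = 0 := by
      ext e
      change j ((LinearMap.range T).mkQ (fun i => f i • e)) = 0
      have : (LinearMap.range T).mkQ (fun i => f i • e) = 0 := by
        rw [Submodule.mkQ_apply, Submodule.Quotient.mk_eq_zero]
        exact ⟨e, rfl⟩
      rw [this, map_zero]
    change TensorProduct.mk R Q G 1 (i (x1 f)) = 0
    rw [h0, map_zero, map_zero]
  · intro v hv
    have hv' : TensorProduct.mk R Q G 1 (i (x1 v)) = 0 := hv
    have hloc : IsLocalizedModule (nonZeroDivisors R) (TensorProduct.mk R Q G 1) :=
      (isLocalizedModule_iff_isBaseChange (nonZeroDivisors R) Q _).mpr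
        (TensorProduct.isBaseChange R G Q)
    obtain ⟨s, hs⟩ := (IsLocalizedModule.eq_zero_iff (nonZeroDivisors R) _).mp hv'
    have hs1 : i (s.1 • x1 v) = 0 := by rw [map_smul]; exact hs
    have hs2 : s.1 • x1 v = 0 := hi (by rw [hs1, map_zero])
    have hs3 : algebraMap R Q s.1 • x0 v (ι 1) = 0 := LinearMap.congr_fun hs2 (ι 1)
    have hs4 : x0 v (ι 1) = 0 :=
      ((IsLocalization.map_units Q s).smul_eq_zero).mp hs3
    rw [hx0] at hs4
    have hs5 : (LinearMap.range T).mkQ (fun i => v i • ι 1) = 0 := hj (by rw [hs4, map_zero])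
    rw [Submodule.mkQ_apply, Submodule.Quotient.mk_eq_zero] at hs5
    obtain ⟨e, he⟩ := hs5
    exact embed_aux Q hQ E ι hι f v e (fun i => congrFun he i)

/-- Let `R` be a commutative ring whose total ring of quotients `Q`
(the localization at the non-zerodivisors) is self FP-injective. Then `R` is semicoherent
if and only if `Q` is coherent. -/
theorem semicoherent_iff_coherent_totalQuotientRing (R : Type u) [CommRing R]
    (hQ : IsFPInjective (Localization (nonZeroDivisors R)) (Localization (nonZeroDivisors R))) :
    IsSemicoherentRing R ↔ IsCoherentRing (Localization (nonZeroDivisors R)) := by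
  exact ⟨coherent_of_semicoherent R hQ, semicoherent_of_coherent R hQ⟩
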